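/- For every positive integer M there exists a positive integer h such that every injective straight-line drawing Γ of the complete 10-ary tree T_10^h in ℝ² has ply-number at least M; that is, there exists a point q ∈ ℝ² such that at least M vertices v of T_10^h satisfy dist(Γ(v), q) < r_v. -/

import Mathlib

/-- Vertices of the complete 10-ary tree of height `h` are the lists over `Fin 10` of
length at most `h`; the root is `[]` and the parent of a nonempty list is its tail. The
ply-radius of a vertex `v` in a drawing `Γ` is half the maximum of the distances from
`Γ v` to the images of its neighbors (its parent, if `v ≠ []`, and its children, i.e.
vertices `u` of length `≤ h` with `u.tail = v`). -/
noncomputable def plyRadius10 (h : ℕ) (Γ : List (Fin 10) → EuclideanSpace ℝ (Fin 2))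
    (v : List (Fin 10)) : ℝ :=
  (1 / 2) * sSup {r : ℝ | ∃ u : List (Fin 10), u.length ≤ h ∧
    ((u.tail = v ∧ u ≠ []) ∨ (v.tail = u ∧ v ≠ [])) ∧ r = dist (Γ v) (Γ u)}

abbrev PlyPt := EuclideanSpace ℝ (Fin 2)
abbrev PlyVx := List (Fin 10)

/-- length of the edge to the parent -/
noncomputable def plyD (Γ : PlyVx → PlyPt) (v : PlyVx) : ℝ := dist (Γ v) (Γ v.tail)

/-- total length of the first `k` edges on the way from `w` to the root -/
noncomputable def plyL (Γ : PlyVx → PlyPt) (w : PlyVx) (k : ℕ) : ℝ :=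
  ∑ i ∈ Finset.range k, plyD Γ (w.drop i)

structure PlyHyp (Γ : PlyVx → PlyPt) (ρ : PlyVx → ℝ) (h M : ℕ) : Prop where
  h1 : ∀ v : PlyVx, v ≠ [] → v.length ≤ h → plyD Γ v / 2 ≤ ρ v
  h2 : ∀ v : PlyVx, v ≠ [] → v.length ≤ h → plyD Γ v / 2 ≤ ρ v.tail
  h3 : ∀ v : PlyVx, v ≠ [] → v.length ≤ h → 0 < plyD Γ v
  h4 : ∀ (q : PlyPt) (S : Finset PlyVx),
    (∀ v ∈ S, v.length ≤ h ∧ dist (Γ v) q < ρ v) → S.card < M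

/-- descendants of `v` exactly `n` levels below -/
def plyDesc (v : PlyVx) : ℕ → Finset PlyVx
  | 0 => {v}
  | n + 1 => (plyDesc v n ×ˢ (Finset.univ : Finset (Fin 10))).image (fun p => p.2 :: p.1)

lemma plyDesc_card (v : PlyVx) (n : ℕ) : (plyDesc v n).card = 10 ^ n := by
  induction n with
  | zero => simp [plyDesc]
  | succ n ih =>
    rw [plyDesc, Finset.card_image_of_injective, Finset.card_product, ih]
    · simp [pow_succ]
    · rintro ⟨a, b⟩ ⟨c, d⟩ hh
      simp at hh
      simp [hh]

lemma mem_plyDesc (v : PlyVx) (n : ℕ) (w : PlyVx) :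
    w ∈ plyDesc v n ↔ w.drop n = v ∧ w.length = n + v.length := by
  induction n generalizing w with
  | zero =>
    simp only [plyDesc, Finset.mem_singleton, List.drop_zero, zero_add]
    constructor
    · rintro rfl; simp
    · exact fun h => h.1
  | succ n ih =>
    simp only [plyDesc, Finset.mem_image, Finset.mem_product, Finset.mem_univ, and_true,
      Prod.exists]
    constructor
    · rintro ⟨a, b, hab, rfl⟩
      rw [ih] at hab
      simp [hab.1, hab.2]; omega
    · rintro ⟨h1, h2⟩
      cases w with
      | nil => simp at h2; omega
      | cons b a =>
        refine ⟨a, b, ?_, rfl⟩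
        rw [ih]
        simp at h1 h2
        exact ⟨h1, by omega⟩

lemma plyDesc_drop {v : PlyVx} {n k : ℕ} {w : PlyVx} (hw : w ∈ plyDesc v n) (hk : k ≤ n) :
    w.drop k ∈ plyDesc v (n - k) := by
  rw [mem_plyDesc] at *
  rw [List.drop_drop, List.length_drop, hw.2]
  refine ⟨?_, by omega⟩
  rw [← hw.1]; congr 1; omega

lemma plyDesc_drop' {v : PlyVx} {n k : ℕ} {w : PlyVx} (hw : w ∈ plyDesc v n) (hk : k ≤ n) :
    w ∈ plyDesc (w.drop k) k := by
  rw [mem_plyDesc] at *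
  rw [List.length_drop, hw.2]
  exact ⟨rfl, by omega⟩

lemma plyD_nonneg (Γ : PlyVx → PlyPt) (v : PlyVx) : 0 ≤ plyD Γ v := dist_nonneg

lemma plyL_nonneg (Γ : PlyVx → PlyPt) (v : PlyVx) (k : ℕ) : 0 ≤ plyL Γ v k :=
  Finset.sum_nonneg fun _ _ => plyD_nonneg _ _

lemma plyL_add (Γ : PlyVx → PlyPt) (w : PlyVx) (a b : ℕ) :
    plyL Γ w (a + b) = plyL Γ w a + plyL Γ (w.drop a) b := by
  simp [plyL, Finset.sum_range_add, List.drop_drop]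

lemma plyL_succ (Γ : PlyVx → PlyPt) (w : PlyVx) (a : ℕ) :
    plyL Γ w (a + 1) = plyL Γ w a + plyD Γ (w.drop a) := by
  simp [plyL, Finset.sum_range_succ]

lemma plyL_dist (Γ : PlyVx → PlyPt) (w : PlyVx) (k : ℕ) :
    dist (Γ w) (Γ (w.drop k)) ≤ plyL Γ w k := by
  have := dist_le_range_sum_dist (fun i => Γ (w.drop i)) k
  simpa [plyL, plyD] using this

/-- packing -/
lemma ply_pack {Γ : PlyVx → PlyPt} {ρ : PlyVx → ℝ} {h M : ℕ} (H : PlyHyp Γ ρ h M)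
    (Q : Finset PlyVx) (x : PlyPt) (r : ℝ) (hr : 0 < r) (N : ℕ) (hN : 1 ≤ N)
    (hQ : ∀ u ∈ Q, u.length ≤ h ∧ dist (Γ u) x ≤ N * r ∧ r ≤ ρ u) :
    Q.card ≤ M * (25 * N ^ 2) := by
  have coord : ∀ (a b : PlyPt) (i : Fin 2), |a i - b i| ≤ dist a b := by
    intro a b i
    have := PiLp.norm_apply_le (a - b) i
    rw [dist_eq_norm]
    simpa using this
  have dle : ∀ (a b : PlyPt), dist a b ≤ |a 0 - b 0| + |a 1 - b 1| := by
    intro a b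
    rw [EuclideanSpace.dist_eq, Fin.sum_univ_two]
    simp only [Real.dist_eq]
    apply Real.sqrt_le_iff.2
    constructor
    · positivity
    · nlinarith [abs_nonneg (a 0 - b 0), abs_nonneg (a 1 - b 1)]
  let f : PlyVx → ℤ × ℤ := fun u => (⌊(Γ u 0 - x 0) / (r / 2)⌋, ⌊(Γ u 1 - x 1) / (r / 2)⌋)
  let I : Finset ℤ := Finset.Icc (-(2 * N : ℤ)) (2 * N)
  have hfl : ∀ u ∈ Q, ∀ i : Fin 2, ⌊(Γ u i - x i) / (r / 2)⌋ ∈ I := by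
    intro u hu i
    have h1 := (coord (Γ u) x i).trans (hQ u hu).2.1
    rw [abs_le] at h1
    have hr2 : 0 < r / 2 := by positivity
    rw [Finset.mem_Icc]
    constructor
    · rw [Int.le_floor, le_div_iff₀ hr2]
      push_cast; linarith
    · rw [← Int.lt_add_one_iff, Int.floor_lt, div_lt_iff₀ hr2]
      push_cast; linarith
  have hcard := Finset.card_le_mul_card_image_of_maps_to (s := Q) (t := I ×ˢ I) (f := f)
    (fun u hu => Finset.mem_product.2 ⟨hfl u hu 0, hfl u hu 1⟩) M ?_
  · refine hcard.trans (Nat.mul_le_mul_left _ ?_)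
    have : I.card = 4 * N + 1 := by
      simp only [I, Int.card_Icc]; omega
    rw [Finset.card_product, this]
    nlinarith
  · intro b _
    by_cases hne : (Q.filter (fun u => f u = b)) = ∅
    · rw [hne]; simp
    obtain ⟨u0, hu0⟩ := Finset.nonempty_iff_ne_empty.2 hne
    refine (H.h4 (Γ u0) _ ?_).le
    intro u hu
    rw [Finset.mem_filter] at hu hu0
    refine ⟨(hQ u hu.1).1, ?_⟩
    have hff : f u = f u0 := hu.2.trans hu0.2.symm
    have key : ∀ i : Fin 2, ⌊(Γ u i - x i) / (r / 2)⌋ = ⌊(Γ u0 i - x i) / (r / 2)⌋ →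
        |Γ u i - Γ u0 i| < r / 2 := by
      intro i hi
      have h2 := Int.abs_sub_lt_one_of_floor_eq_floor hi
      rw [← sub_div, abs_div, abs_of_pos (by positivity : 0 < r / 2),
        div_lt_one (by positivity)] at h2
      simpa using h2
    have k0 := key 0 (congrArg Prod.fst hff)
    have k1 := key 1 (congrArg Prod.snd hff)
    linarith [dle (Γ u) (Γ u0), (hQ u hu.1).2.2]

open Classical in
/-- descendants with no good proper ancestors -/
noncomputable def plyA (Γ : PlyVx → PlyPt) (v : PlyVx) (n : ℕ) : Finset PlyVx :=
  (plyDesc v n).filter fun u => ∃ e : ℝ, 0 ≤ e ∧ 2 * e < plyD Γ u ∧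
    ∀ k, 0 < k → k ≤ n → plyD Γ (u.drop k) ≤ 2 * (plyL Γ u k + e)

open Classical in
lemma ply_mark {Γ : PlyVx → PlyPt} {ρ : PlyVx → ℝ} {h M : ℕ} (H : PlyHyp Γ ρ h M)
    (v : PlyVx) (hv : v ≠ []) (n : ℕ) (hn : n + v.length ≤ h) :
    ∃ X : Finset PlyVx, X.card ≤ 10 * M + 1 ∧ v ∈ X ∧
      (∀ k < n, ∀ c ∈ plyDesc v (k + 1), 2 * plyL Γ c.tail (k + 1) < plyD Γ c → c ∈ X) := by
  let Y : Finset PlyVx := (Finset.range n).biUnion fun k =>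
    (plyDesc v k).filter fun y => ∃ a : Fin 10, 2 * plyL Γ y (k + 1) < plyD Γ (a :: y)
  have hY : Y.card < M := by
    refine H.h4 (Γ v) Y ?_
    intro y hy
    simp only [Y, Finset.mem_biUnion, Finset.mem_filter, Finset.mem_range] at hy
    obtain ⟨k, hk, hyd, a, ha⟩ := hy
    have hm := (mem_plyDesc _ _ _).1 hyd
    refine ⟨by omega, ?_⟩
    have h1 := plyL_dist Γ y k
    rw [hm.1] at h1
    have h2 := plyL_succ Γ y k
    rw [hm.1] at h2
    have h3 := H.h3 v hv (by omega)
    have h4 := H.h2 (a :: y) (by simp) (by simp; omega)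
    simp only [List.tail_cons] at h4
    linarith [plyL_nonneg Γ y k]
  refine ⟨insert v ((Y ×ˢ (Finset.univ : Finset (Fin 10))).image (fun p => p.2 :: p.1)), ?_,
    by simp, ?_⟩
  · refine (Finset.card_insert_le _ _).trans ?_
    have := Finset.card_image_le (s := Y ×ˢ (Finset.univ : Finset (Fin 10)))
      (f := fun p => p.2 :: p.1)
    rw [Finset.card_product, Finset.card_univ, Fintype.card_fin] at this
    omega
  · intro k hk c hc hlt
    rw [Finset.mem_insert]; right
    rw [Finset.mem_image]
    cases c with
    | nil => rw [mem_plyDesc] at hc; simp at hc; omega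
    | cons a y =>
      refine ⟨(y, a), ?_, rfl⟩
      rw [Finset.mem_product]
      refine ⟨?_, Finset.mem_univ _⟩
      simp only [Y, Finset.mem_biUnion, Finset.mem_filter, Finset.mem_range]
      refine ⟨k, hk, ?_, a, by simpa using hlt⟩
      rw [mem_plyDesc] at *
      simp at hc
      exact ⟨hc.1, by omega⟩

lemma ply_scale (d s : ℝ) (n : ℕ) (h1 : d ≤ s) (h2 : s ≤ 3 ^ (n + 1) * d) :
    ∃ a ≤ n, 3 ^ a * d ≤ s ∧ s ≤ 3 ^ (a + 1) * d := by
  induction n with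
  | zero => exact ⟨0, le_rfl, by simpa using h1, h2⟩
  | succ n ih =>
    by_cases hs : s ≤ 3 ^ (n + 1) * d
    · obtain ⟨a, ha, hh⟩ := ih hs
      exact ⟨a, by omega, hh⟩
    · exact ⟨n + 1, le_rfl, by linarith, h2⟩

open Classical in
lemma ply_core {Γ : PlyVx → PlyPt} {ρ : PlyVx → ℝ} {h M : ℕ} (H : PlyHyp Γ ρ h M)
    (v : PlyVx) (hv : v ≠ []) (n : ℕ) (hn : n + v.length ≤ h) :
    (plyA Γ v n).card ≤ (2025 * M * (10 * M + 1)) * (n + 1) * 9 ^ n := by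
  obtain ⟨X, hXc, hvX, hX⟩ := ply_mark H v hv n hn
  let Q : PlyVx × ℕ → Finset PlyVx := fun p => (plyDesc v n).filter fun u =>
    0 < plyD Γ p.1 ∧
    dist (Γ u) (Γ p.1) ≤ 3 ^ (p.2 + 1) * plyD Γ p.1 ∧
      3 ^ (p.2 + 1) * plyD Γ p.1 ≤ 3 ^ (n + 2) * (plyD Γ u / 2)
  have hvl : 0 < v.length := List.length_pos_iff.2 hv
  have hQ : ∀ p, (Q p).card ≤ M * (25 * (3 ^ (n + 2)) ^ 2) := by
    intro p
    by_cases hp : 0 < plyD Γ p.1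
    · refine ply_pack H (Q p) (Γ p.1) (3 ^ (p.2 + 1) * plyD Γ p.1 / 3 ^ (n + 2))
        (by positivity) (3 ^ (n + 2)) (Nat.one_le_pow _ _ (by norm_num)) ?_
      intro u hu
      rw [Finset.mem_filter, mem_plyDesc] at hu
      refine ⟨by omega, ?_, ?_⟩
      · push_cast
        rw [mul_div_cancel₀ _ (by positivity)]
        exact hu.2.2.1
      · refine le_trans ?_ (H.h1 u ?_ (by omega))
        · rw [div_le_iff₀ (by positivity)]
          linarith [hu.2.2.2]
        · rw [← List.length_pos_iff]; omega
    · have : Q p = ∅ := by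
        apply Finset.filter_eq_empty_iff.2
        intro u _ hu
        exact hp hu.1
      rw [this]; simp
  have hsub : plyA Γ v n ⊆ (X ×ˢ Finset.range (n + 1)).biUnion Q := by
    intro u hu
    rw [plyA, Finset.mem_filter] at hu
    obtain ⟨hud, e, he0, he1, he⟩ := hu
    have hm := (mem_plyDesc _ _ _).1 hud
    have hex : ∃ k, k = n ∨ (k < n ∧
        2 * plyL Γ (u.drop (k + 1)) (n - k) < plyD Γ (u.drop k)) := ⟨n, Or.inl rfl⟩
    obtain ⟨k, hk, hmin⟩ : ∃ k, (k = n ∨ (k < n ∧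
        2 * plyL Γ (u.drop (k + 1)) (n - k) < plyD Γ (u.drop k))) ∧
        ∀ j < k, ¬ (j = n ∨ (j < n ∧
        2 * plyL Γ (u.drop (j + 1)) (n - j) < plyD Γ (u.drop j))) :=
      ⟨Nat.find hex, Nat.find_spec hex, fun j hj => Nat.find_min hex hj⟩
    have hkn : k ≤ n := by rcases hk with h | h <;> omega
    set x := u.drop k with hx
    have hxX : x ∈ X := by
      rcases hk with h | h
      · rw [hx, h, hm.1]; exact hvX
      · refine hX (n - k - 1) (by omega) x ?_ ?_
        · have := plyDesc_drop hud hkn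
          rwa [show n - k - 1 + 1 = n - k by omega]
        · rw [hx, List.tail_drop, show n - k - 1 + 1 = n - k by omega]
          exact h.2
    have hxl : x.length = n - k + v.length := by
      rw [hx, List.length_drop, hm.2]; omega
    have hxd : 0 < plyD Γ x := H.h3 x (by rw [← List.length_pos_iff]; omega) (by omega)
    have hB : ∀ j, j ≤ k → plyL Γ (u.drop (k - j)) (n + 1 - (k - j)) ≤
        3 ^ j * (3 / 2 * plyD Γ x) := by
      intro j
      induction j with
      | zero =>
        intro _
        simp only [Nat.sub_zero, pow_zero, one_mul]
        rw [← hx, show n + 1 - k = 1 + (n - k) by omega, plyL_add]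
        have e1 : plyL Γ x 1 = plyD Γ x := by simp [plyL]
        have e2 : x.drop 1 = u.drop (k + 1) := by rw [hx, List.drop_drop]
        rw [e1, e2]
        rcases hk with h | h
        · rw [h, Nat.sub_self]
          simp only [plyL, Finset.range_zero, Finset.sum_empty]
          linarith
        · linarith [h.2]
      | succ j ih =>
        intro hj
        have ih := ih (by omega)
        have h1 := hmin (k - (j + 1)) (by omega)
        push Not at h1
        have h2 := h1.2 (by omega)
        rw [show n + 1 - (k - (j + 1)) = 1 + (n + 1 - (k - j)) by omega, plyL_add,
          List.drop_drop, show k - (j + 1) + 1 = k - j by omega]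
        rw [show k - (j + 1) + 1 = k - j by omega,
          show n - (k - (j + 1)) = n + 1 - (k - j) by omega] at h2
        have e1 : plyL Γ (u.drop (k - (j + 1))) 1 = plyD Γ (u.drop (k - (j + 1))) := by
          simp [plyL]
        rw [e1, pow_succ]
        linarith
    have hB' := hB k le_rfl
    simp only [Nat.sub_self, List.drop_zero, Nat.sub_zero] at hB'
    have hT : ∀ j, j ≤ n → plyL Γ u (j + 1) + e ≤ 3 ^ j * (3 / 2 * plyD Γ u) := by
      intro j
      induction j with
      | zero =>
        intro _
        have e1 : plyL Γ u (0 + 1) = plyD Γ u := by simp [plyL]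
        rw [e1, pow_zero]; linarith
      | succ j ih =>
        intro hj
        have ih := ih (by omega)
        have h1 := he (j + 1) (by omega) hj
        rw [plyL_succ, pow_succ]
        linarith
    have hT' := hT k hkn
    have hs1 : plyD Γ x ≤ plyL Γ u (k + 1) := by
      rw [plyL_succ]; linarith [plyL_nonneg Γ u k]
    have h3kn : (3 : ℝ) ^ k ≤ 3 ^ n := pow_le_pow_right₀ (by norm_num) hkn
    have hs2 : plyL Γ u (k + 1) ≤ 3 ^ (n + 1) * plyD Γ x := by
      have : plyL Γ u (k + 1) ≤ plyL Γ u (n + 1) := by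
        have e0 := plyL_add Γ u (k + 1) (n - k)
        rw [show (k + 1) + (n - k) = n + 1 by omega] at e0
        linarith [plyL_nonneg Γ (u.drop (k + 1)) (n - k)]
      have h5 := mul_le_mul_of_nonneg_right h3kn hxd.le
      rw [pow_succ]
      have : (0 : ℝ) ≤ 3 ^ n * plyD Γ x := by positivity
      linarith
    obtain ⟨a, ha, ha1, ha2⟩ := ply_scale _ _ _ hs1 hs2
    rw [Finset.mem_biUnion]
    refine ⟨(x, a), Finset.mem_product.2 ⟨hxX, Finset.mem_range.2 (by omega)⟩, ?_⟩
    rw [Finset.mem_filter]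
    refine ⟨hud, hxd, ?_, ?_⟩
    · have h6 := plyL_dist Γ u k
      have h7 := plyL_succ Γ u k
      dsimp only
      rw [← hx] at h6 h7
      linarith
    · dsimp only
      have h5 := mul_le_mul_of_nonneg_right h3kn (plyD_nonneg Γ u)
      rw [pow_succ, pow_add]
      linarith
  refine (Finset.card_le_card hsub).trans (Finset.card_biUnion_le.trans ?_)
  refine (Finset.sum_le_card_nsmul _ _ _ (fun p _ => hQ p)).trans ?_
  rw [Finset.card_product, Finset.card_range, smul_eq_mul]
  have e9 : ((3 : ℕ) ^ (n + 2)) ^ 2 = 81 * 9 ^ n := by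
    rw [← pow_mul, mul_comm, pow_mul]; norm_num; ring
  rw [e9]
  calc X.card * (n + 1) * (M * (25 * (81 * 9 ^ n)))
      ≤ (10 * M + 1) * (n + 1) * (M * (25 * (81 * 9 ^ n))) := by gcongr
    _ = _ := by ring

open Classical in
/-- good ancestors -/
noncomputable def plyG (Γ : PlyVx → PlyPt) (w : PlyVx) (n : ℕ) : Finset ℕ :=
  (Finset.range (n + 1)).filter fun k => 2 * plyL Γ w k < plyD Γ (w.drop k)

open Classical in
noncomputable def plyW (Γ : PlyVx → PlyPt) (m : ℕ) (v : PlyVx) (n : ℕ) : Finset PlyVx :=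
  (plyDesc v n).filter fun w => (plyG Γ w n).card ≤ m

open Classical in
lemma ply_rec {Γ : PlyVx → PlyPt} {ρ : PlyVx → ℝ} {h M : ℕ} (H : PlyHyp Γ ρ h M)
    (m : ℕ) (v : PlyVx) (hv : v ≠ []) (n : ℕ) (hn : n + v.length ≤ h) :
    plyW Γ (m + 1) v n ⊆ plyA Γ v n ∪ (Finset.range n).biUnion fun i =>
      (plyA Γ v i ×ˢ (Finset.univ : Finset (Fin 10))).biUnion fun p =>
        plyW Γ m (p.2 :: p.1) (n - i - 1) := by
  intro w hw
  rw [plyW, Finset.mem_filter] at hw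
  obtain ⟨hwd, hwc⟩ := hw
  have hm := (mem_plyDesc _ _ _).1 hwd
  have hvl : 0 < v.length := List.length_pos_iff.2 hv
  have h0 : 0 ∈ plyG Γ w n := by
    rw [plyG, Finset.mem_filter]
    refine ⟨by simp, ?_⟩
    have := H.h3 w (by rw [← List.length_pos_iff]; omega) (by omega)
    simpa [plyL] using this
  obtain ⟨k, hkG, hmax⟩ := Finset.exists_max_image (plyG Γ w n) id ⟨0, h0⟩
  have hkG' := hkG
  rw [plyG, Finset.mem_filter, Finset.mem_range] at hkG'
  have hkn : k ≤ n := by omega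
  have huA : w.drop k ∈ plyA Γ v (n - k) := by
    rw [plyA, Finset.mem_filter]
    refine ⟨plyDesc_drop hwd hkn, plyL Γ w k, plyL_nonneg _ _ _, hkG'.2, ?_⟩
    intro j hj0 hj
    by_contra hcon
    push Not at hcon
    have : k + j ∈ plyG Γ w n := by
      rw [plyG, Finset.mem_filter, Finset.mem_range]
      refine ⟨by omega, ?_⟩
      rw [plyL_add]
      rw [List.drop_drop] at hcon
      linarith
    have := hmax _ this
    simp at this
    omega
  rw [Finset.mem_union]
  rcases Nat.eq_zero_or_pos k with hk0 | hk0
  · left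
    subst hk0
    simpa using huA
  · right
    rw [Finset.mem_biUnion]
    refine ⟨n - k, Finset.mem_range.2 (by omega), ?_⟩
    rw [Finset.mem_biUnion]
    have hlt : k - 1 < w.length := by omega
    have hcons : w.drop (k - 1) = w[k - 1] :: w.drop k := by
      rw [List.drop_eq_getElem_cons hlt]
      congr 2
      omega
    refine ⟨(w.drop k, w[k - 1]), Finset.mem_product.2 ⟨huA, Finset.mem_univ _⟩, ?_⟩
    dsimp only
    rw [← hcons, plyW, Finset.mem_filter, show n - (n - k) - 1 = k - 1 by omega]
    refine ⟨plyDesc_drop' hwd (by omega), ?_⟩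
    have : plyG Γ w (k - 1) ⊆ (plyG Γ w n).erase k := by
      intro j hj
      rw [plyG, Finset.mem_filter, Finset.mem_range] at hj
      rw [Finset.mem_erase, plyG, Finset.mem_filter, Finset.mem_range]
      exact ⟨by omega, by omega, hj.2⟩
    have := Finset.card_le_card this
    rw [Finset.card_erase_of_mem hkG] at this
    omega

open Classical in
lemma ply_count {Γ : PlyVx → PlyPt} {ρ : PlyVx → ℝ} {h M : ℕ} (H : PlyHyp Γ ρ h M)
    (D : ℕ) (hD : D = 2025 * M * (10 * M + 1)) (N : ℕ)
    (m : ℕ) : ∀ (v : PlyVx) (_ : v ≠ []) (n : ℕ) (_ : n ≤ N) (_ : n + v.length ≤ h),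
    (plyW Γ m v n).card ≤ (3 * D * (N + 1) ^ 2) ^ m * 9 ^ n := by
  have hM : 1 ≤ M := by
    have := H.h4 0 ∅ (by simp)
    omega
  have hD1 : 1 ≤ D := by rw [hD]; nlinarith
  have hE : 1 ≤ 3 * D * (N + 1) ^ 2 := by
    have : 1 ≤ (N + 1) ^ 2 := Nat.one_le_pow _ _ (by omega)
    nlinarith
  induction m with
  | zero =>
    intro v hv n hnN hn
    have hz : plyW Γ 0 v n = ∅ := by
      apply Finset.eq_empty_of_forall_notMem
      intro w hw
      rw [plyW, Finset.mem_filter] at hw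
      have hm := (mem_plyDesc _ _ _).1 hw.1
      have hvl : 0 < v.length := List.length_pos_iff.2 hv
      have h0 : 0 ∈ plyG Γ w n := by
        rw [plyG, Finset.mem_filter]
        refine ⟨by simp, ?_⟩
        have := H.h3 w (by rw [← List.length_pos_iff]; omega) (by omega)
        simpa [plyL] using this
      have := Finset.card_pos.2 ⟨0, h0⟩
      omega
    rw [hz]; simp
  | succ m ih =>
    intro v hv n hnN hn
    set c := (3 * D * (N + 1) ^ 2) ^ m with hc
    have hc1 : 1 ≤ c := Nat.one_le_pow _ _ hE
    have hA : ∀ i ≤ n, (plyA Γ v i).card ≤ D * (N + 1) * 9 ^ i := by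
      intro i hi
      have := ply_core H v hv i (by omega)
      rw [← hD] at this
      refine this.trans ?_
      gcongr
      omega
    have hterm : ∀ i ∈ Finset.range n,
        ((plyA Γ v i ×ˢ (Finset.univ : Finset (Fin 10))).biUnion fun p =>
        plyW Γ m (p.2 :: p.1) (n - i - 1)).card ≤ D * (N + 1) * (2 * (c * 9 ^ n)) := by
      intro i hi
      rw [Finset.mem_range] at hi
      refine Finset.card_biUnion_le.trans ?_
      refine (Finset.sum_le_card_nsmul _ _ (c * 9 ^ (n - i - 1)) ?_).trans ?_
      · intro p hp
        rw [Finset.mem_product, plyA, Finset.mem_filter, mem_plyDesc] at hp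
        refine ih _ (by simp) _ (by omega) ?_
        simp only [List.length_cons]
        omega
      · rw [Finset.card_product, Finset.card_univ, Fintype.card_fin, smul_eq_mul]
        have h9 : 9 ^ n = 9 ^ i * (9 * 9 ^ (n - i - 1)) := by
          rw [← pow_succ', ← pow_add]; congr 1; omega
        calc (plyA Γ v i).card * 10 * (c * 9 ^ (n - i - 1))
            ≤ (D * (N + 1) * 9 ^ i) * 18 * (c * 9 ^ (n - i - 1)) := by
              gcongr
              · exact hA i hi.le
              · norm_num
          _ = _ := by rw [h9]; ring
    refine (Finset.card_le_card (ply_rec H m v hv n hn)).trans ?_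
    refine (Finset.card_union_le _ _).trans ?_
    refine (Nat.add_le_add (hA n le_rfl) (Finset.card_biUnion_le.trans
      (Finset.sum_le_card_nsmul _ _ _ hterm))).trans ?_
    rw [Finset.card_range, smul_eq_mul, pow_succ, ← hc]
    calc D * (N + 1) * 9 ^ n + n * (D * (N + 1) * (2 * (c * 9 ^ n)))
        ≤ D * (N + 1) * (c * 9 ^ n) + N * (D * (N + 1) * (2 * (c * 9 ^ n))) := by
          gcongr
          nlinarith [Nat.one_le_pow n 9 (by norm_num)]
      _ = D * (N + 1) * (c * 9 ^ n) * (1 + 2 * N) := by ring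
      _ ≤ D * (N + 1) * (c * 9 ^ n) * (3 * (N + 1)) := by gcongr; omega
      _ = _ := by ring

lemma ply_final {Γ : PlyVx → PlyPt} {ρ : PlyVx → ℝ} {n M : ℕ} (H : PlyHyp Γ ρ (n + 1) M) :
    10 ^ n ≤ (3 * (2025 * M * (10 * M + 1)) * (n + 1) ^ 2) ^ M * 9 ^ n := by
  classical
  have h1 := ply_count H _ rfl n M [0] (by simp) n le_rfl (by simp)
  have h2 : plyW Γ M [0] n = plyDesc [0] n := by
    rw [plyW, Finset.filter_eq_self]
    intro w hw
    have hm := (mem_plyDesc _ _ _).1 hw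
    simp only [List.length_singleton] at hm
    have hinj : Set.InjOn (fun k => w.drop k) (plyG Γ w n : Set ℕ) := by
      intro a ha b hb hab
      rw [Finset.mem_coe, plyG, Finset.mem_filter, Finset.mem_range] at ha hb
      have := congrArg List.length hab
      simp only [List.length_drop] at this
      omega
    rw [← Finset.card_image_of_injOn hinj]
    refine (H.h4 (Γ w) _ ?_).le
    intro y hy
    rw [Finset.mem_image] at hy
    obtain ⟨k, hk, rfl⟩ := hy
    rw [plyG, Finset.mem_filter, Finset.mem_range] at hk
    have hl : (w.drop k).length = w.length - k := List.length_drop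
    refine ⟨by omega, ?_⟩
    have := H.h1 (w.drop k) (by rw [← List.length_pos_iff]; omega) (by omega)
    have h3 := plyL_dist Γ w k
    rw [dist_comm]
    linarith [hk.2]
  rw [h2, plyDesc_card] at h1
  exact h1

lemma ply_growth (C M : ℕ) : ∃ n : ℕ, (C * (n + 1) ^ 2) ^ M * 9 ^ n < 10 ^ n := by
  have h1 := tendsto_pow_const_div_const_pow_of_one_lt (2 * M) (show (1 : ℝ) < 10 / 9 by norm_num)
  have h2 := (h1.comp (Filter.tendsto_add_atTop_nat 1)).const_mul ((C : ℝ) ^ M * (10 / 9))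
  rw [mul_zero] at h2
  obtain ⟨n, hn⟩ := (h2.eventually (gt_mem_nhds one_pos)).exists
  refine ⟨n, ?_⟩
  have h3 : ((C : ℝ) ^ M * (10 / 9)) * (((n + 1 : ℕ) : ℝ) ^ (2 * M) / (10 / 9) ^ (n + 1)) < 1 := hn
  have e : ((C : ℝ) ^ M * (10 / 9)) * (((n + 1 : ℕ) : ℝ) ^ (2 * M) / (10 / 9) ^ (n + 1)) =
      ((C : ℝ) * ((n + 1 : ℕ) : ℝ) ^ 2) ^ M * 9 ^ n / 10 ^ n := by
    rw [pow_succ, mul_pow, ← pow_mul, div_pow]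
    field_simp
  rw [e, div_lt_one (by positivity)] at h3
  exact_mod_cast h3

lemma plyRadius10_ge (h : ℕ) (Γ : PlyVx → PlyPt) (v u : PlyVx) (hu : u.length ≤ h)
    (huv : (u.tail = v ∧ u ≠ []) ∨ (v.tail = u ∧ v ≠ [])) :
    dist (Γ v) (Γ u) / 2 ≤ plyRadius10 h Γ v := by
  have hb : BddAbove {r : ℝ | ∃ u : List (Fin 10), u.length ≤ h ∧
    ((u.tail = v ∧ u ≠ []) ∨ (v.tail = u ∧ v ≠ [])) ∧ r = dist (Γ v) (Γ u)} := by
    have hf : {u : List (Fin 10) | u.length ≤ h}.Finite := List.finite_length_le _ _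
    refine ((hf.image (fun u => dist (Γ v) (Γ u))).subset ?_).bddAbove
    rintro r ⟨u, h1, _, rfl⟩
    exact ⟨u, h1, rfl⟩
  have := le_csSup hb ⟨u, hu, huv, rfl⟩
  unfold plyRadius10
  linarith

/-- For every `M ≥ 1` there is a height `h ≥ 1` such that every injective straight-line
drawing of the complete 10-ary tree of height `h` has ply-number at least `M`: some point
`q` of the plane lies in the ply-disks of at least `M` vertices. -/
theorem stmt10 : ∀ M : ℕ, 1 ≤ M → ∃ h : ℕ, 1 ≤ h ∧
    ∀ Γ : List (Fin 10) → EuclideanSpace ℝ (Fin 2),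
      (∀ l₁ l₂ : List (Fin 10),
        l₁.length ≤ h → l₂.length ≤ h → Γ l₁ = Γ l₂ → l₁ = l₂) →
      ∃ q : EuclideanSpace ℝ (Fin 2), ∃ S : Finset (List (Fin 10)),
        M ≤ S.card ∧ ∀ v ∈ S, v.length ≤ h ∧ dist (Γ v) q < plyRadius10 h Γ v := by
  intro M _
  obtain ⟨n, hn⟩ := ply_growth (3 * (2025 * M * (10 * M + 1))) M
  refine ⟨n + 1, by omega, ?_⟩
  intro Γ hinj
  by_contra hcon
  push Not at hcon
  have H : PlyHyp Γ (plyRadius10 (n + 1) Γ) (n + 1) M := by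
    constructor
    · intro v hv hl
      exact plyRadius10_ge _ _ _ _ (by simp; omega) (Or.inr ⟨rfl, hv⟩)
    · intro v hv hl
      rw [plyD, dist_comm]
      exact plyRadius10_ge _ _ _ _ hl (Or.inl ⟨rfl, hv⟩)
    · intro v hv hl
      refine dist_pos.2 fun he => ?_
      have := congrArg List.length (hinj v v.tail hl (by simp; omega) he)
      have hvl : 0 < v.length := List.length_pos_iff.2 hv
      simp at this
      omega
    · intro q S hS
      by_contra hc
      obtain ⟨v, hv, h1⟩ := hcon q S (by omega)
      have h2 := hS v hv
      linarith [h1 h2.1]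
  exact absurd (ply_final H) (not_le.2 hn)
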